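/- arXiv:2404.06701 — 2 statements merged into one kernel-verified Lean document; each statement's English description precedes it below -/
import Mathlib

section
/- Let n, p, q be positive integers, let x_i ∈ ℝ^q and real weights T_i > 0 for i = 1,…,n, and let S_1,…,S_n be symmetric positive semidefinite p×p real matrices. Define ℓ(β,γ) = (1/2)·Σ_{i=1}^n T_i·( x_i^⊤β + (γ^⊤ S_i γ)·exp(−x_i^⊤β) ) for β ∈ ℝ^q and γ ∈ ℝ^p. Then ℓ is biconvex: for every fixed γ ∈ ℝ^p the map β ↦ ℓ(β,γ) is convex on ℝ^q, and for every fixed β ∈ ℝ^q the map γ ↦ ℓ(β,γ) is convex on ℝ^p. -/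
open scoped BigOperators Matrix

lemma quad_convex_aux {p : ℕ} (S : Matrix (Fin p) (Fin p) ℝ) (hS : S.PosSemidef)
    (u v : Fin p → ℝ) (a b : ℝ) (ha : 0 ≤ a) (hb : 0 ≤ b) (hab : a + b = 1) :
    (a • u + b • v) ⬝ᵥ S.mulVec (a • u + b • v) ≤
      a * (u ⬝ᵥ S.mulVec u) + b * (v ⬝ᵥ S.mulVec v) := by
  have h := hS.dotProduct_mulVec_nonneg (u - v)
  rw [star_trivial] at h
  have hab' := mul_nonneg (mul_nonneg ha hb) h
  simp only [Matrix.mulVec_add, Matrix.mulVec_sub, Matrix.mulVec_smul, add_dotProduct,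
    dotProduct_add, sub_dotProduct, dotProduct_sub, smul_dotProduct, dotProduct_smul,
    smul_eq_mul] at hab' ⊢
  obtain rfl : b = 1 - a := by linarith
  linarith

/-- Biconvexity of the covariance-regression negative log-likelihood
`ℓ(β,γ) = (1/2)·Σᵢ Tᵢ·(xᵢᵀβ + (γᵀSᵢγ)·exp(−xᵢᵀβ))`. -/
theorem stmt0 (n p q : ℕ) (hn : 0 < n) (hp : 0 < p) (hq : 0 < q)
    (x : Fin n → Fin q → ℝ) (T : Fin n → ℝ) (hT : ∀ i, 0 < T i)
    (S : Fin n → Matrix (Fin p) (Fin p) ℝ) (hS : ∀ i, (S i).PosSemidef)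
    (ℓ : (Fin q → ℝ) → (Fin p → ℝ) → ℝ)
    (hℓ : ∀ β γ, ℓ β γ =
      (1 / 2) * ∑ i, T i * ((∑ j, x i j * β j)
        + (γ ⬝ᵥ (S i).mulVec γ) * Real.exp (-(∑ j, x i j * β j)))) :
    (∀ γ : Fin p → ℝ, ConvexOn ℝ Set.univ fun β => ℓ β γ) ∧
    (∀ β : Fin q → ℝ, ConvexOn ℝ Set.univ fun γ => ℓ β γ) := by
  constructor
  · intro γ
    refine ⟨convex_univ, fun u _ v _ a b ha hb hab => ?_⟩
    simp only [hℓ, smul_eq_mul]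
    rw [mul_left_comm a, mul_left_comm b, ← mul_add, Finset.mul_sum _ _ a, Finset.mul_sum _ _ b,
      ← Finset.sum_add_distrib]
    refine mul_le_mul_of_nonneg_left (Finset.sum_le_sum fun i _ => ?_) (by norm_num)
    rw [mul_left_comm a, mul_left_comm b, ← mul_add]
    refine mul_le_mul_of_nonneg_left ?_ (hT i).le
    have hlin : (∑ j, x i j * (a • u + b • v) j)
        = a * (∑ j, x i j * u j) + b * (∑ j, x i j * v j) := by
      rw [Finset.mul_sum, Finset.mul_sum, ← Finset.sum_add_distrib]
      refine Finset.sum_congr rfl fun j _ => ?_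
      simp only [Pi.add_apply, Pi.smul_apply, smul_eq_mul]
      ring
    rw [hlin]
    generalize (∑ j, x i j * u j) = s
    generalize (∑ j, x i j * v j) = t
    have hQ := (hS i).dotProduct_mulVec_nonneg γ
    rw [star_trivial] at hQ
    have he := convexOn_exp.2 (Set.mem_univ (-s)) (Set.mem_univ (-t)) ha hb hab
    simp only [smul_eq_mul] at he
    rw [show a * -s + b * -t = -(a * s + b * t) by ring] at he
    have := mul_le_mul_of_nonneg_left he hQ
    linarith
  · intro β
    refine ⟨convex_univ, fun u _ v _ a b ha hb hab => ?_⟩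
    simp only [hℓ, smul_eq_mul]
    rw [mul_left_comm a, mul_left_comm b, ← mul_add, Finset.mul_sum _ _ a, Finset.mul_sum _ _ b,
      ← Finset.sum_add_distrib]
    refine mul_le_mul_of_nonneg_left (Finset.sum_le_sum fun i _ => ?_) (by norm_num)
    rw [mul_left_comm a, mul_left_comm b, ← mul_add]
    refine mul_le_mul_of_nonneg_left ?_ (hT i).le
    generalize (∑ j, x i j * β j) = s
    have := mul_le_mul_of_nonneg_right (quad_convex_aux (S i) (hS i) u v a b ha hb hab)
      (Real.exp_pos (-s)).le
    obtain rfl : b = 1 - a := by linarith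
    linarith
end

section
/- Let q ≥ 1, let x_i ∈ ℝ^q and positive integers T_i for i = 1,…,n, let c_{it} be reals with c_{it} ≥ c_min > 0 for 1 ≤ t ≤ T_i, set M_n = Σ_{i=1}^n T_i, and define L_n(β) = (1/(2M_n))·Σ_{i=1}^n Σ_{t=1}^{T_i} ( x_i^⊤β + c_{it}·e^{−x_i^⊤β} ). Suppose the design satisfies the restricted-eigenvalue bound (1/M_n)·Σ_{i=1}^n T_i·(x_i^⊤Δ)² ≥ α·‖Δ‖₂² − τ·‖Δ‖₁² for all Δ ∈ ℝ^q, with constants α, τ ≥ 0. Fix β* ∈ ℝ^q and B ∈ ℝ. Then for every β ∈ ℝ^q such that x_i^⊤β ≤ B and x_i^⊤β* ≤ B for all i, the restricted strong convexity inequality holds: ⟨∇L_n(β) − ∇L_n(β*), β − β*⟩ ≥ (c_min·e^{−B}·α/2)·‖β − β*‖₂² − (c_min·e^{−B}·τ/2)·‖β − β*‖₁². -/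
open scoped BigOperators RealInnerProductSpace

/-- Scalar strong monotonicity of `-exp (-u)` on `(-∞, B]`, ordered case. -/
lemma key_ordered (u v B : ℝ) (hu : u ≤ B) (hvu : v ≤ u) :
    Real.exp (-B) * (u - v) ^ 2 ≤ (Real.exp (-v) - Real.exp (-u)) * (u - v) := by
  have h1 : Real.exp (-v) = Real.exp (-u) * Real.exp (u - v) := by
    rw [← Real.exp_add]; congr 1; ring
  have h2 := Real.add_one_le_exp (u - v)
  have h3 : Real.exp (-B) ≤ Real.exp (-u) := Real.exp_le_exp.2 (by linarith)
  have h4 : Real.exp (-B) * (u - v) ≤ Real.exp (-v) - Real.exp (-u) := by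
    rw [h1]
    have := mul_le_mul_of_nonneg_left h2 (Real.exp_pos (-u)).le
    have := mul_le_mul_of_nonneg_right h3 (sub_nonneg.2 hvu)
    linarith
  have := mul_le_mul_of_nonneg_right h4 (sub_nonneg.2 hvu)
  linarith

lemma key_scalar (u v B : ℝ) (hu : u ≤ B) (hv : v ≤ B) :
    Real.exp (-B) * (u - v) ^ 2 ≤ (Real.exp (-v) - Real.exp (-u)) * (u - v) := by
  rcases le_total v u with h | h
  · exact key_ordered u v B hu h
  · have := key_ordered v u B hv h
    linarith

/-- Deterministic restricted strong convexity of the covariance-regression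
negative log-likelihood `L_n(β) = (1/(2Mₙ))·Σᵢ Σₜ (xᵢᵀβ + c_{it}·e^{−xᵢᵀβ})`. -/
theorem stmt2 (q : ℕ) (hq : 1 ≤ q) (n : ℕ)
    (x : Fin n → EuclideanSpace ℝ (Fin q))
    (T : Fin n → ℕ) (hT : ∀ i, 0 < T i)
    (c : (i : Fin n) → Fin (T i) → ℝ) (cmin : ℝ) (hcmin : 0 < cmin)
    (hc : ∀ i t, cmin ≤ c i t)
    (M : ℕ) (hM : M = ∑ i, T i)
    (L : EuclideanSpace ℝ (Fin q) → ℝ)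
    (hL : ∀ β, L β = (1 / (2 * (M : ℝ))) *
      ∑ i, ∑ t : Fin (T i), (⟪x i, β⟫ + c i t * Real.exp (-⟪x i, β⟫)))
    (α τ : ℝ) (hα : 0 ≤ α) (hτ : 0 ≤ τ)
    (hRE : ∀ Δ : EuclideanSpace ℝ (Fin q),
      (1 / (M : ℝ)) * ∑ i, (T i : ℝ) * (⟪x i, Δ⟫) ^ 2 ≥
        α * ‖Δ‖ ^ 2 - τ * (∑ j, |Δ j|) ^ 2)
    (βstar : EuclideanSpace ℝ (Fin q)) (B : ℝ) :
    ∀ β : EuclideanSpace ℝ (Fin q),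
      (∀ i, ⟪x i, β⟫ ≤ B) → (∀ i, ⟪x i, βstar⟫ ≤ B) →
      ⟪gradient L β - gradient L βstar, β - βstar⟫ ≥
        (cmin * Real.exp (-B) * α / 2) * ‖β - βstar‖ ^ 2 -
        (cmin * Real.exp (-B) * τ / 2) * (∑ j, |(β - βstar) j|) ^ 2 := by
  intro β hβ hβs
  have hgrad : ∀ b d : EuclideanSpace ℝ (Fin q), ⟪gradient L b, d⟫ =
      (1 / (2 * (M : ℝ))) * ∑ i, ∑ t : Fin (T i),
        (⟪x i, d⟫ - c i t * Real.exp (-⟪x i, b⟫) * ⟪x i, d⟫) := by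
    intro b d
    have hi : ∀ i, HasFDerivAt (fun b : EuclideanSpace ℝ (Fin q) => ⟪x i, b⟫)
        (innerSL ℝ (x i)) b := fun i => (innerSL ℝ (x i)).hasFDerivAt
    have hF := (HasFDerivAt.fun_sum (u := Finset.univ) fun i _ =>
      HasFDerivAt.fun_sum (u := (Finset.univ : Finset (Fin (T i)))) fun t _ =>
        (hi i).add (((hi i).neg.exp).const_mul (c i t))).const_mul (1 / (2 * (M : ℝ)))
    have hF2 := HasFDerivAt.congr_of_eventuallyEq hF (Filter.Eventually.of_forall hL)
    rw [hF2.hasGradientAt.gradient, InnerProductSpace.toDual_symm_apply]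
    simp only [_root_.smul_apply, _root_.sum_apply,
      _root_.add_apply, _root_.neg_apply, innerSL_apply_apply,
      smul_eq_mul, Pi.neg_apply]
    congr 1
    refine Finset.sum_congr rfl fun i _ => Finset.sum_congr rfl fun t _ => ?_
    ring
  have hdiff : ⟪gradient L β - gradient L βstar, β - βstar⟫ =
      (1 / (2 * (M : ℝ))) * ∑ i, ∑ t : Fin (T i),
        c i t * ((Real.exp (-⟪x i, βstar⟫) - Real.exp (-⟪x i, β⟫)) * ⟪x i, β - βstar⟫) := by
    rw [inner_sub_left, hgrad, hgrad, ← mul_sub, ← Finset.sum_sub_distrib]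
    congr 1
    refine Finset.sum_congr rfl fun i _ => ?_
    rw [← Finset.sum_sub_distrib]
    refine Finset.sum_congr rfl fun t _ => ?_
    ring
  have hsum : ∑ i, (T i : ℝ) * (cmin * (Real.exp (-B) * ⟪x i, β - βstar⟫ ^ 2)) ≤
      ∑ i, ∑ t : Fin (T i),
        c i t * ((Real.exp (-⟪x i, βstar⟫) - Real.exp (-⟪x i, β⟫)) * ⟪x i, β - βstar⟫) := by
    refine Finset.sum_le_sum fun i _ => ?_
    have hle : ∀ t : Fin (T i), cmin * (Real.exp (-B) * ⟪x i, β - βstar⟫ ^ 2) ≤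
        c i t * ((Real.exp (-⟪x i, βstar⟫) - Real.exp (-⟪x i, β⟫)) * ⟪x i, β - βstar⟫) := by
      intro t
      have hk := key_scalar _ _ B (hβ i) (hβs i)
      rw [← inner_sub_right] at hk
      exact mul_le_mul (hc i t) hk (by positivity) (hcmin.le.trans (hc i t))
    have := Finset.sum_le_sum fun (t : Fin (T i)) (_ : t ∈ Finset.univ) => hle t
    simpa using this
  have hRE' := mul_le_mul_of_nonneg_left (hRE (β - βstar))
    (show 0 ≤ cmin * Real.exp (-B) / 2 by positivity)
  have h5 := mul_le_mul_of_nonneg_left hsum (show 0 ≤ 1 / (2 * (M : ℝ)) by positivity)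
  have h6 : (1 / (2 * (M : ℝ))) *
      ∑ i, (T i : ℝ) * (cmin * (Real.exp (-B) * ⟪x i, β - βstar⟫ ^ 2)) =
      cmin * Real.exp (-B) / 2 * ((1 / (M : ℝ)) * ∑ i, (T i : ℝ) * ⟪x i, β - βstar⟫ ^ 2) := by
    have h7 : ∑ i, (T i : ℝ) * (cmin * (Real.exp (-B) * ⟪x i, β - βstar⟫ ^ 2)) =
        cmin * Real.exp (-B) * ∑ i, (T i : ℝ) * ⟪x i, β - βstar⟫ ^ 2 := by
      rw [Finset.mul_sum]
      exact Finset.sum_congr rfl fun i _ => by ring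
    have h8 : 1 / (2 * (M : ℝ)) = 1 / 2 * (1 / (M : ℝ)) := by
      rw [one_div_mul_one_div]
    rw [h7, h8]; ring
  rw [hdiff]
  linarith
end
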